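/- arXiv:1911.11830 — 3 statements merged into one kernel-verified Lean document; each statement's English description precedes it below -/
import Mathlib

section
/- Assume e ≠ 0. Then the 2×3 matrix J has rank strictly less than 2 if and only if cos(α)·G_u − 2 sin(α)·√E·G·κ₂ ≠ 0 and r = −2√E·G/(cos(α)·G_u − 2 sin(α)·√E·G·κ₂). (This is the β = 0 case of the characterization of when the two-parameter family of lines through a surface in the direction v_{α,β} admits an envelope.) -/
noncomputable section

open Real

def dot3 (a b : Fin 3 → ℝ) : ℝ := a 0 * b 0 + a 1 * b 1 + a 2 * b 2

def cross3 (a b : Fin 3 → ℝ) : Fin 3 → ℝ :=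
  ![a 1 * b 2 - a 2 * b 1, a 2 * b 0 - a 0 * b 2, a 0 * b 1 - a 1 * b 0]

def norm3 (a : Fin 3 → ℝ) : ℝ := Real.sqrt (dot3 a a)

noncomputable def pdu {X : Type*} [NormedAddCommGroup X] [NormedSpace ℝ X]
    (f : ℝ × ℝ → X) : ℝ × ℝ → X := fun p => deriv (fun t => f (t, p.2)) p.1

noncomputable def pdv {X : Type*} [NormedAddCommGroup X] [NormedSpace ℝ X]
    (f : ℝ × ℝ → X) : ℝ × ℝ → X := fun p => deriv (fun t => f (p.1, t)) p.2

noncomputable def pd (i j : ℕ) (f : ℝ × ℝ → ℝ) : ℝ × ℝ → ℝ :=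
  (pdu (X := ℝ))^[i] ((pdv (X := ℝ))^[j] f)

def mongeSurf (f : ℝ × ℝ → ℝ) : ℝ × ℝ → Fin 3 → ℝ := fun p => ![p.1, p.2, f p]

noncomputable def unitNormal (ψ : ℝ × ℝ → Fin 3 → ℝ) : ℝ × ℝ → Fin 3 → ℝ := fun p =>
  (norm3 (cross3 (pdu ψ p) (pdv ψ p)))⁻¹ • cross3 (pdu ψ p) (pdv ψ p)

noncomputable def coefE (f : ℝ × ℝ → ℝ) : ℝ × ℝ → ℝ := fun p => 1 + (pdu f p) ^ 2
noncomputable def coefG (f : ℝ × ℝ → ℝ) : ℝ × ℝ → ℝ := fun p => 1 + (pdv f p) ^ 2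

noncomputable def kap2 (f : ℝ × ℝ → ℝ) : ℝ × ℝ → ℝ := fun p =>
  dot3 (pdv (pdv (mongeSurf f)) p) (unitNormal (mongeSurf f) p) / coefG f p

noncomputable def rfun (α : ℝ) (f : ℝ × ℝ → ℝ) : ℝ × ℝ → ℝ := fun p =>
  -(2 * Real.sqrt (coefE f p) * coefG f p) /
    (Real.cos α * pdu (coefG f) p -
      2 * Real.sin α * Real.sqrt (coefE f p) * coefG f p * kap2 f p)

noncomputable def evolutoid (α : ℝ) (f : ℝ × ℝ → ℝ) : ℝ × ℝ → Fin 3 → ℝ := fun p =>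
  mongeSurf f p +
    rfun α f p •
      ((Real.cos α / Real.sqrt (coefE f p)) • pdu (mongeSurf f) p +
        Real.sin α • unitNormal (mongeSurf f) p)

def MongeHyp (κ₁ κ₂ : ℝ) (a : ℕ → ℕ → ℝ) (f : ℝ × ℝ → ℝ) : Prop :=
  ContDiff ℝ (⊤ : ℕ∞) f ∧ f (0, 0) = 0 ∧
    pdu f (0, 0) = 0 ∧ pdv f (0, 0) = 0 ∧
    pd 2 0 f (0, 0) = κ₁ ∧ pd 1 1 f (0, 0) = 0 ∧ pd 0 2 f (0, 0) = κ₂ ∧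
    ∀ i j : ℕ, 3 ≤ i + j → i + j ≤ 4 → pd i j f (0, 0) = a i j

noncomputable def gaussK (ψ : ℝ × ℝ → Fin 3 → ℝ) : ℝ × ℝ → ℝ := fun p =>
  (dot3 (pdu (pdu ψ) p) (unitNormal ψ p) * dot3 (pdv (pdv ψ) p) (unitNormal ψ p) -
      dot3 (pdu (pdv ψ) p) (unitNormal ψ p) ^ 2) /
    (norm3 (pdu ψ p) ^ 2 * norm3 (pdv ψ p) ^ 2 - (dot3 (pdu ψ p) (pdv ψ p)) ^ 2)

def AEquivalentAt {E F : Type*} [NormedAddCommGroup E] [NormedSpace ℝ E]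
    [NormedAddCommGroup F] [NormedSpace ℝ F]
    (f : E → F) (p : E) (g : E → F) (q : E) : Prop :=
  ∃ (h : PartialHomeomorph E E) (ξ : PartialHomeomorph F F),
    p ∈ h.source ∧ h p = q ∧
    ContDiffOn ℝ (⊤ : ℕ∞) h h.source ∧ ContDiffOn ℝ (⊤ : ℕ∞) h.symm h.target ∧
    f p ∈ ξ.source ∧ ξ (f p) = g q ∧
    ContDiffOn ℝ (⊤ : ℕ∞) ξ ξ.source ∧ ContDiffOn ℝ (⊤ : ℕ∞) ξ.symm ξ.target ∧
    ∀ᶠ x in nhds p, ξ (f x) = g (h x)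

theorem rank_lt_two_iff_not_linearIndependent_row (A : Matrix (Fin 2) (Fin 3) ℝ) :
    A.rank < 2 ↔ ¬ LinearIndependent ℝ A.row := by
  rw [linearIndependent_iff_card_le_finrank_span, Set.finrank,
    ← A.rank_eq_finrank_span_row, Fintype.card_fin, not_le]

theorem rank_lt_two_iff_of_second_row_single (a b c d : ℝ) (h : a ≠ 0 ∨ c ≠ 0) :
    (!![a, b, c; 0, d, 0] : Matrix (Fin 2) (Fin 3) ℝ).rank < 2 ↔ d = 0 := by
  rw [rank_lt_two_iff_not_linearIndependent_row, not_iff_comm]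
  change ¬d = 0 ↔ LinearIndependent ℝ ![![a, b, c], ![0, d, 0]]
  rw [LinearIndependent.pair_iff]
  constructor
  · intro hd s t hst
    have h0 : s * a = 0 := by simpa using congrFun hst 0
    have h1 : s * b + t * d = 0 := by simpa using congrFun hst 1
    have h2 : s * c = 0 := by simpa using congrFun hst 2
    have hs : s = 0 := by
      rcases h with h | h
      · exact (mul_eq_zero.mp h0).resolve_right h
      · exact (mul_eq_zero.mp h2).resolve_right h
    subst hs
    exact ⟨rfl, by simpa [hd] using h1⟩
  · rintro hli rfl
    refine one_ne_zero (hli 0 1 ?_).2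
    ext i
    fin_cases i <;> simp

theorem evolutoid_envelope_condition_beta_zero
    (α E G Ev Gu e g r κ₁ κ₂ : ℝ)
    (hα : α ∈ Set.Ioo 0 (Real.pi / 2)) (hE : 0 < E) (hG : 0 < G)
    (hκ₁ : κ₁ = e / E) (hκ₂ : κ₂ = g / G) (he : e ≠ 0)
    (J : Matrix (Fin 2) (Fin 3) ℝ)
    (hJ : J = !![-1 + r * Real.sin α * κ₁,
                 r * Real.cos α * Ev / (2 * G * Real.sqrt E),
                 -(r * Real.cos α * e / Real.sqrt E);
                 0,
                 -1 - r * (Real.cos α * Gu / (2 * G * Real.sqrt E) - Real.sin α * κ₂),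
                 0]) :
    J.rank < 2 ↔
      (Real.cos α * Gu - 2 * Real.sin α * Real.sqrt E * G * κ₂ ≠ 0 ∧
        r = -(2 * Real.sqrt E * G) /
            (Real.cos α * Gu - 2 * Real.sin α * Real.sqrt E * G * κ₂)) := by
  have hs : 0 < Real.sqrt E := Real.sqrt_pos.mpr hE
  have hcos : 0 < Real.cos α :=
    Real.cos_pos_of_mem_Ioo ⟨by linarith [hα.1, Real.pi_pos], hα.2⟩
  have hrow : -1 + r * Real.sin α * κ₁ ≠ 0 ∨ -(r * Real.cos α * e / Real.sqrt E) ≠ 0 := by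
    by_cases hr : r = 0
    · left; simp [hr]
    · right; exact neg_ne_zero.mpr (div_ne_zero (mul_ne_zero (mul_ne_zero hr hcos.ne') he) hs.ne')
  rw [hJ, rank_lt_two_iff_of_second_row_single _ _ _ _ hrow]
  have hSG : 0 < 2 * Real.sqrt E * G := by positivity
  set D := Real.cos α * Gu - 2 * Real.sin α * Real.sqrt E * G * κ₂ with hD
  have hentry : -1 - r * (Real.cos α * Gu / (2 * G * Real.sqrt E) - Real.sin α * κ₂) =
      -(2 * Real.sqrt E * G + r * D) / (2 * Real.sqrt E * G) := by
    rw [hD]; field_simp; ring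
  rw [hentry, div_eq_zero_iff, or_iff_left hSG.ne', neg_eq_zero]
  constructor
  · intro h
    have hD0 : D ≠ 0 := by
      intro h0
      rw [h0, mul_zero, add_zero] at h
      exact hSG.ne' h
    exact ⟨hD0, (eq_div_iff hD0).mpr (by linarith)⟩
  · rintro ⟨hD0, hr⟩
    linarith [(eq_div_iff hD0).mp hr]
end
end

section
/- Assume g ≠ 0. Then the 2×3 matrix J has rank strictly less than 2 if and only if cos(α)·E_v − 2 sin(α)·E·√G·κ₁ ≠ 0 and r = −2E·√G/(cos(α)·E_v − 2 sin(α)·E·√G·κ₁). (This is the β = π/2 case of the characterization of when the two-parameter family of lines through a surface in the direction v_{α,β} admits an envelope.) -/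
noncomputable section

open Real

theorem Matrix.rank_lt_two_iff_not_linearIndependent_rows {n : Type*} [Fintype n]
    (M : Matrix (Fin 2) n ℝ) : M.rank < 2 ↔ ¬ LinearIndependent ℝ M.row := by
  have hle : M.rank ≤ 2 := by simpa using M.rank_le_card_height
  rw [linearIndependent_iff_card_eq_finrank_span, Fintype.card_fin, Set.finrank,
    ← Matrix.rank_eq_finrank_span_row]
  omega

theorem Matrix.rank_lt_two_iff_of_row_zero_eq (a b c d : ℝ) (hcd : c ≠ 0 ∨ d ≠ 0) :
    (!![a, 0, 0; b, c, d]).rank < 2 ↔ a = 0 := by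
  rw [Matrix.rank_lt_two_iff_not_linearIndependent_rows, not_iff_comm,
    show (!![a, 0, 0; b, c, d]).row = ![![a, 0, 0], ![b, c, d]] from rfl,
    LinearIndependent.pair_iff]
  have key (s t : ℝ) :
      s • ![a, 0, 0] + t • ![b, c, d] = 0 ↔
        s * a + t * b = 0 ∧ t * c = 0 ∧ t * d = 0 := by
    simp [funext_iff, Fin.forall_fin_succ]
  simp only [key]
  constructor
  · intro ha s t ⟨h₁, h₂, h₃⟩
    have ht : t = 0 := by
      rcases hcd with hc | hd
      · exact (mul_eq_zero.mp h₂).resolve_right hc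
      · exact (mul_eq_zero.mp h₃).resolve_right hd
    subst ht
    simpa [ha] using h₁
  · intro h ha
    simpa using (h 1 0 (by simp [ha])).1

theorem evolutoid_envelope_condition_beta_pi_div_two
    (α E G Ev Gu e g r κ₁ κ₂ : ℝ)
    (hα : α ∈ Set.Ioo 0 (Real.pi / 2)) (hE : 0 < E) (hG : 0 < G)
    (hκ₁ : κ₁ = e / E) (hκ₂ : κ₂ = g / G) (hg : g ≠ 0)
    (J : Matrix (Fin 2) (Fin 3) ℝ)
    (hJ : J = !![-1 - r * (Real.cos α * Ev / (2 * E * Real.sqrt G) - Real.sin α * κ₁),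
                 0,
                 0;
                 r * Real.cos α * Gu / (2 * E * Real.sqrt G),
                 -1 + r * Real.sin α * κ₂,
                 -(r * Real.cos α * g / Real.sqrt G)]) :
    J.rank < 2 ↔
      (Real.cos α * Ev - 2 * Real.sin α * E * Real.sqrt G * κ₁ ≠ 0 ∧
        r = -(2 * E * Real.sqrt G) /
            (Real.cos α * Ev - 2 * Real.sin α * E * Real.sqrt G * κ₁)) := by
  have hcos : Real.cos α ≠ 0 :=
    (Real.cos_pos_of_mem_Ioo ⟨by linarith [hα.1, Real.pi_pos], hα.2⟩).ne'
  have hsG : Real.sqrt G ≠ 0 := (Real.sqrt_pos.mpr hG).ne'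
  have hEG : 2 * E * Real.sqrt G ≠ 0 := mul_ne_zero (mul_ne_zero two_ne_zero hE.ne') hsG
  have hrow : -1 + r * Real.sin α * κ₂ ≠ 0 ∨ -(r * Real.cos α * g / Real.sqrt G) ≠ 0 := by
    by_cases hr : r = 0
    · left
      simp [hr]
    · right
      exact neg_ne_zero.mpr (div_ne_zero (mul_ne_zero (mul_ne_zero hr hcos) hg) hsG)
  rw [hJ, Matrix.rank_lt_two_iff_of_row_zero_eq _ _ _ _ hrow]
  set D := Real.cos α * Ev - 2 * Real.sin α * E * Real.sqrt G * κ₁ with hD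
  have hentry : Real.cos α * Ev / (2 * E * Real.sqrt G) - Real.sin α * κ₁ =
      D / (2 * E * Real.sqrt G) := by
    rw [hD]
    field_simp
  have hzero : -1 - r * (D / (2 * E * Real.sqrt G)) = 0 ↔ r * D = -(2 * E * Real.sqrt G) := by
    rw [← mul_div_assoc, sub_eq_zero, eq_comm, div_eq_iff hEG, neg_one_mul]
  rw [hentry, hzero]
  constructor
  · intro h
    have hD0 : D ≠ 0 := by
      intro h0
      rw [h0, mul_zero] at h
      exact hEG (neg_eq_zero.mp h.symm)
    exact ⟨hD0, (eq_div_iff hD0).mpr h⟩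
  · rintro ⟨hD0, h⟩
    exact (eq_div_iff hD0).mp h
end
end

section
/- The evolutoid satisfies E₁(0,0) = (cot(α)/κ₂, 0, 1/κ₂), ∂_u E₁(0,0) = ((κ₂(κ₂−κ₁) − a₁₂ cot(α))/κ₂², 0, (−a₁₂ + κ₁κ₂ cot(α))/κ₂²), and ∂_v E₁(0,0) = (−a₀₃ cot(α)/κ₂², 0, −a₀₃/κ₂²). -/
noncomputable section

open Real

theorem pdu_eq_fderiv {f : ℝ × ℝ → ℝ} (hf : Differentiable ℝ f) :
    pdu f = fun p => fderiv ℝ f p (1, 0) := by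
  funext p
  have h : HasDerivAt (fun t : ℝ => (t, p.2)) ((1 : ℝ), (0 : ℝ)) p.1 :=
    (hasDerivAt_id p.1).prodMk (hasDerivAt_const p.1 p.2)
  exact ((hf p).hasFDerivAt.comp_hasDerivAt p.1 h).deriv

theorem pdv_eq_fderiv {f : ℝ × ℝ → ℝ} (hf : Differentiable ℝ f) :
    pdv f = fun p => fderiv ℝ f p (0, 1) := by
  funext p
  have h : HasDerivAt (fun t : ℝ => (p.1, t)) ((0 : ℝ), (1 : ℝ)) p.2 :=
    (hasDerivAt_const p.2 p.1).prodMk (hasDerivAt_id p.2)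
  exact ((hf p).hasFDerivAt.comp_hasDerivAt p.2 h).deriv

theorem ContDiff.differentiable_of_top {f : ℝ × ℝ → ℝ} (hf : ContDiff ℝ (⊤ : ℕ∞) f) :
    Differentiable ℝ f :=
  hf.differentiable (by simp)

theorem ContDiff.pdu {f : ℝ × ℝ → ℝ} (hf : ContDiff ℝ (⊤ : ℕ∞) f) :
    ContDiff ℝ (⊤ : ℕ∞) (pdu f) := by
  rw [pdu_eq_fderiv hf.differentiable_of_top]
  exact (hf.fderiv_right (by simp)).clm_apply contDiff_const

theorem ContDiff.pdv {f : ℝ × ℝ → ℝ} (hf : ContDiff ℝ (⊤ : ℕ∞) f) :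
    ContDiff ℝ (⊤ : ℕ∞) (pdv f) := by
  rw [pdv_eq_fderiv hf.differentiable_of_top]
  exact (hf.fderiv_right (by simp)).clm_apply contDiff_const

theorem hasDerivAt_pdu {f : ℝ × ℝ → ℝ} (hf : ContDiff ℝ (⊤ : ℕ∞) f) (p : ℝ × ℝ) :
    HasDerivAt (fun t => f (t, p.2)) (pdu f p) p.1 := by
  have h : Differentiable ℝ fun t : ℝ => f (t, p.2) :=
    hf.differentiable_of_top.comp (by fun_prop)
  exact (h p.1).hasDerivAt

theorem hasDerivAt_pdv {f : ℝ × ℝ → ℝ} (hf : ContDiff ℝ (⊤ : ℕ∞) f) (p : ℝ × ℝ) :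
    HasDerivAt (fun t => f (p.1, t)) (pdv f p) p.2 := by
  have h : Differentiable ℝ fun t : ℝ => f (p.1, t) :=
    hf.differentiable_of_top.comp (by fun_prop)
  exact (h p.2).hasDerivAt

theorem pdv_pdu_comm {f : ℝ × ℝ → ℝ} (hf : ContDiff ℝ (⊤ : ℕ∞) f) (p : ℝ × ℝ) :
    pdv (pdu f) p = pdu (pdv f) p := by
  have hd : Differentiable ℝ (fderiv ℝ f) :=
    (hf.fderiv_right (m := (⊤ : ℕ∞)) (by simp)).differentiable (by simp)
  rw [pdv_eq_fderiv hf.pdu.differentiable_of_top, pdu_eq_fderiv hf.pdv.differentiable_of_top,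
    pdu_eq_fderiv hf.differentiable_of_top, pdv_eq_fderiv hf.differentiable_of_top]
  have key : ∀ v w : ℝ × ℝ, fderiv ℝ (fun q => fderiv ℝ f q v) p w
      = fderiv ℝ (fderiv ℝ f) p w v := by
    intro v w
    rw [fderiv_clm_apply (hd p) (differentiableAt_const v)]
    simp
  simp only [key]
  have h2 : minSmoothness ℝ 2 ≤ (⊤ : ℕ∞) := by
    rw [minSmoothness_of_isRCLikeNormedField]
    exact WithTop.coe_le_coe.2 le_top
  exact (hf.contDiffAt.isSymmSndFDerivAt h2).eq _ _

theorem hasDerivAt_vec3 {a b c : ℝ → ℝ} {a' b' c' t : ℝ} (ha : HasDerivAt a a' t)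
    (hb : HasDerivAt b b' t) (hc : HasDerivAt c c' t) :
    HasDerivAt (fun s => ![a s, b s, c s]) ![a', b', c'] t := by
  rw [hasDerivAt_pi]
  intro i
  fin_cases i <;> simpa

theorem pdu_mongeSurf {f : ℝ × ℝ → ℝ} (hf : ContDiff ℝ (⊤ : ℕ∞) f) :
    pdu (mongeSurf f) = fun p => ![1, 0, pdu f p] := by
  funext p
  exact (hasDerivAt_vec3 (hasDerivAt_id p.1) (hasDerivAt_const p.1 p.2)
    (hasDerivAt_pdu hf p)).deriv

theorem pdv_mongeSurf {f : ℝ × ℝ → ℝ} (hf : ContDiff ℝ (⊤ : ℕ∞) f) :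
    pdv (mongeSurf f) = fun p => ![0, 1, pdv f p] := by
  funext p
  exact (hasDerivAt_vec3 (hasDerivAt_const p.2 p.1) (hasDerivAt_id p.2)
    (hasDerivAt_pdv hf p)).deriv

theorem pdv_pdv_mongeSurf {f : ℝ × ℝ → ℝ} (hf : ContDiff ℝ (⊤ : ℕ∞) f) :
    pdv (pdv (mongeSurf f)) = fun p => ![0, 0, pdv (pdv f) p] := by
  rw [pdv_mongeSurf hf]
  funext p
  exact (hasDerivAt_vec3 (hasDerivAt_const p.2 0) (hasDerivAt_const p.2 1)
    (hasDerivAt_pdv hf.pdv p)).deriv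

theorem pdu_coefG {f : ℝ × ℝ → ℝ} (hf : ContDiff ℝ (⊤ : ℕ∞) f) (p : ℝ × ℝ) :
    pdu (coefG f) p = 2 * pdv f p * pdu (pdv f) p := by
  have h := ((hasDerivAt_pdu hf.pdv p).pow 2).const_add 1
  refine h.deriv.trans ?_
  simp

/-- The distance `r` as a function of `p = f_u`, `q = f_v`, `m = f_uv`, `w = f_vv`. -/
def jetRadius (α p q m w : ℝ) : ℝ :=
  -(2 * √(1 + p ^ 2) * (1 + q ^ 2)) /
    (cos α * (2 * q * m) -
      2 * sin α * √(1 + p ^ 2) * (1 + q ^ 2) * (w * (√(p ^ 2 + q ^ 2 + 1))⁻¹ / (1 + q ^ 2)))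

/-- The evolutoid point over `(x, y, z)` as a function of the 2-jet of the Monge function. -/
def jetEvolutoid (α x y z p q m w : ℝ) : Fin 3 → ℝ :=
  ![x + jetRadius α p q m w *
      (cos α / √(1 + p ^ 2) - sin α * ((√(p ^ 2 + q ^ 2 + 1))⁻¹ * p)),
    y - jetRadius α p q m w * (sin α * ((√(p ^ 2 + q ^ 2 + 1))⁻¹ * q)),
    z + jetRadius α p q m w *
      (cos α / √(1 + p ^ 2) * p + sin α * (√(p ^ 2 + q ^ 2 + 1))⁻¹)]

theorem evolutoid_eq_jetEvolutoid {f : ℝ × ℝ → ℝ} (hf : ContDiff ℝ (⊤ : ℕ∞) f) (α : ℝ)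
    (p : ℝ × ℝ) :
    evolutoid α f p = jetEvolutoid α p.1 p.2 (f p) (pdu f p) (pdv f p) (pdu (pdv f) p)
      (pdv (pdv f) p) := by
  have hN : unitNormal (mongeSurf f) p =
      (√(pdu f p ^ 2 + pdv f p ^ 2 + 1))⁻¹ • ![-pdu f p, -pdv f p, 1] := by
    have hc : cross3 (pdu (mongeSurf f) p) (pdv (mongeSurf f) p) =
        ![-pdu f p, -pdv f p, 1] := by
      simp [pdu_mongeSurf hf, pdv_mongeSurf hf, cross3]
    rw [unitNormal, hc, norm3, dot3]
    simp [pow_two]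
  have hr : rfun α f p = jetRadius α (pdu f p) (pdv f p) (pdu (pdv f) p) (pdv (pdv f) p) := by
    simp [rfun, jetRadius, kap2, hN, pdv_pdv_mongeSurf hf, pdu_coefG hf, coefE, coefG, dot3]
  rw [evolutoid, hr, hN, pdu_mongeSurf hf, jetEvolutoid]
  ext i
  fin_cases i <;> simp [mongeSurf, coefE, -mul_eq_mul_left_iff] <;> ring

theorem hasDerivAt_jetEvolutoid {α κ : ℝ} (hs : sin α ≠ 0) (hκ : κ ≠ 0)
    {x y z p q m w : ℝ → ℝ} {x' y' z' p' q' m' w' t : ℝ}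
    (hx : HasDerivAt x x' t) (hy : HasDerivAt y y' t) (hz : HasDerivAt z z' t)
    (hp : HasDerivAt p p' t) (hq : HasDerivAt q q' t) (hm : HasDerivAt m m' t)
    (hw : HasDerivAt w w' t) (p0 : p t = 0) (q0 : q t = 0) (m0 : m t = 0) (w0 : w t = κ) :
    HasDerivAt (fun s => jetEvolutoid α (x s) (y s) (z s) (p s) (q s) (m s) (w s))
      ![x' - p' / κ - w' * cot α / κ ^ 2, y' - q' / κ, z' + p' * cot α / κ - w' / κ ^ 2] t := by
  have hE : HasDerivAt (fun s => √(1 + p s ^ 2)) 0 t := by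
    refine (((hp.fun_pow 2).const_add 1).sqrt (by simp [p0])).congr_deriv ?_
    simp [p0]
  have hG : HasDerivAt (fun s => 1 + q s ^ 2) 0 t := by
    refine ((hq.fun_pow 2).const_add 1).congr_deriv ?_
    simp [q0]
  have hn : HasDerivAt (fun s => (√(p s ^ 2 + q s ^ 2 + 1))⁻¹) 0 t := by
    refine (((((hp.fun_pow 2).fun_add (hq.fun_pow 2)).add_const 1).sqrt
      (by simp [p0, q0])).fun_inv (by simp [p0, q0])).congr_deriv ?_
    simp [p0, q0]
  have hr : HasDerivAt (fun s => jetRadius α (p s) (q s) (m s) (w s))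
      (-w' / (sin α * κ ^ 2)) t := by
    unfold jetRadius
    refine ((((hE.const_mul 2).fun_mul hG).fun_neg).fun_div
      ((((hq.const_mul 2).fun_mul hm).const_mul (cos α)).fun_sub
        (((hE.const_mul (2 * sin α)).fun_mul hG).fun_mul
          ((hw.fun_mul hn).fun_div hG (by simp [q0]))))
      (by simp [p0, q0, w0, hs, hκ])).congr_deriv ?_
    simp [p0, q0, m0, w0]
    field_simp
  have r0 : jetRadius α (p t) (q t) (m t) (w t) = 1 / (sin α * κ) := by
    simp [jetRadius, p0, q0, m0, w0]
    field_simp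
  have hc : HasDerivAt (fun s => cos α / √(1 + p s ^ 2)) 0 t := by
    refine ((hasDerivAt_const t (cos α)).fun_div hE (by simp [p0])).congr_deriv ?_
    simp
  unfold jetEvolutoid
  refine hasDerivAt_vec3 ?_ ?_ ?_
  · refine (hx.fun_add (hr.fun_mul (hc.fun_sub ((hn.fun_mul hp).const_mul (sin α))))).congr_deriv ?_
    rw [r0, cot_eq_cos_div_sin]
    simp [p0, q0]
    field_simp
    ring
  · refine (hy.fun_sub (hr.fun_mul ((hn.fun_mul hq).const_mul (sin α)))).congr_deriv ?_
    rw [r0]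
    simp [p0, q0]
    field_simp
  · refine (hz.fun_add (hr.fun_mul ((hc.fun_mul hp).fun_add (hn.const_mul (sin α))))).congr_deriv ?_
    rw [r0, cot_eq_cos_div_sin]
    simp [p0, q0]
    field_simp
    ring

theorem evolutoid_value_and_first_partials
    (α κ₁ κ₂ : ℝ) (a : ℕ → ℕ → ℝ) (f : ℝ × ℝ → ℝ)
    (hα : α ∈ Set.Ioo 0 (Real.pi / 2))
    (hκ : κ₂ < κ₁) (hκ₁ : κ₁ ≠ 0) (hκ₂ : κ₂ ≠ 0)
    (hf : MongeHyp κ₁ κ₂ a f) :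
    evolutoid α f (0, 0) = ![Real.cot α / κ₂, 0, 1 / κ₂] ∧
    pdu (evolutoid α f) (0, 0) =
      ![(κ₂ * (κ₂ - κ₁) - a 1 2 * Real.cot α) / κ₂ ^ 2, 0,
        (-(a 1 2) + κ₁ * κ₂ * Real.cot α) / κ₂ ^ 2] ∧
    pdv (evolutoid α f) (0, 0) =
      ![-(a 0 3) * Real.cot α / κ₂ ^ 2, 0, -(a 0 3) / κ₂ ^ 2] := by
  obtain ⟨hc, h0, hu, hv, huu, huv, hvv, ha⟩ := hf
  have hs : sin α ≠ 0 :=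
    (sin_pos_of_pos_of_lt_pi hα.1 (by linarith [hα.2, Real.pi_pos])).ne'
  have hvu : pdv (pdu f) (0, 0) = 0 := (pdv_pdu_comm hc _).trans huv
  have h12 : pdu (pdv (pdv f)) (0, 0) = a 1 2 := ha 1 2 (by norm_num) (by norm_num)
  have h03 : pdv (pdv (pdv f)) (0, 0) = a 0 3 := ha 0 3 (by norm_num) (by norm_num)
  change pdu (pdu f) (0, 0) = κ₁ at huu
  change pdu (pdv f) (0, 0) = 0 at huv
  change pdv (pdv f) (0, 0) = κ₂ at hvv
  have hE : evolutoid α f = _ := funext (evolutoid_eq_jetEvolutoid hc α)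
  rw [hE]
  refine ⟨?_, ?_, ?_⟩
  · simp only [h0, hu, hv, huv, hvv, jetEvolutoid, jetRadius, cot_eq_cos_div_sin]
    ext i
    fin_cases i <;> simp <;> field_simp
  · refine (hasDerivAt_jetEvolutoid hs hκ₂ (hasDerivAt_id _) (hasDerivAt_const _ _)
      (hasDerivAt_pdu hc _) (hasDerivAt_pdu hc.pdu _) (hasDerivAt_pdu hc.pdv _)
      (hasDerivAt_pdu hc.pdv.pdu _) (hasDerivAt_pdu hc.pdv.pdv _) hu hv huv hvv).deriv.trans ?_
    rw [hu, huu, huv, h12]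
    ext i
    fin_cases i <;> simp <;> field_simp <;> ring
  · refine (hasDerivAt_jetEvolutoid hs hκ₂ (hasDerivAt_const _ _) (hasDerivAt_id _)
      (hasDerivAt_pdv hc _) (hasDerivAt_pdv hc.pdu _) (hasDerivAt_pdv hc.pdv _)
      (hasDerivAt_pdv hc.pdv.pdu _) (hasDerivAt_pdv hc.pdv.pdv _) hu hv huv hvv).deriv.trans ?_
    rw [hv, hvu, hvv, h03]
    ext i
    fin_cases i <;> simp [hκ₂] <;> field_simp
end
end
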